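/- Fix 0 < a < 2. As n → ∞ along even integers, one has P^{G2}_{2n}(a,1) · n^{5} · 4^{−n} → 48a² / (π(a−2)⁴); that is, P^{G2}_{2n}(a,1) is asymptotic to [48a²/(π(a−2)⁴)] · 4^n / n^5. -/

import Mathlib

open Finset Filter

attribute [local instance] Classical.propDecidable

/-- Height (second coordinate) of a binomial path after `i` steps, starting at height `c`;
steps are encoded by `s : Fin n → Bool` (`true` = up step `(1,1)`, `false` = down step `(1,-1)`).
The path visits the points `(x₀ + i, hgt c s i)` for `0 ≤ i ≤ n`. -/
def hgt {n : ℕ} (c : ℤ) (s : Fin n → Bool) (i : ℕ) : ℤ :=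
  c + ∑ j ∈ Finset.range i, (if h : j < n then (if s ⟨j, h⟩ then (1 : ℤ) else -1) else 0)

/-- The path lies in the upper half-plane (all second coordinates ≥ 0). -/
def InUHP {n : ℕ} (c : ℤ) (s : Fin n → Bool) : Prop :=
  ∀ i ≤ n, 0 ≤ hgt c s i

/-- The number of vertices of the path with second coordinate 0. -/
def visits {n : ℕ} (c : ℤ) (s : Fin n → Bool) : ℕ :=
  ((Finset.range (n + 1)).filter (fun i => hgt c s i = 0)).card

/-- `s¹_n(k,m)`: the number of pairs `(σ, τ)` of binomial paths of length `n` in the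
upper half-plane, with `σ` from `(0,0)` to `(n,m)`, `τ` from `(0,2)` to `(n,k+2)`, and
the second coordinate of `τᵢ` strictly greater than that of `σᵢ` for all `0 ≤ i ≤ n`. -/
noncomputable def s1Count (n k m : ℕ) : ℕ :=
  ((Finset.univ : Finset ((Fin n → Bool) × (Fin n → Bool))).filter
    (fun p => InUHP 0 p.1 ∧ InUHP 2 p.2 ∧ (∀ i ≤ n, hgt 0 p.1 i < hgt 2 p.2 i) ∧
      hgt 0 p.1 n = (m : ℤ) ∧ hgt 2 p.2 n = (k : ℤ) + 2)).card

/-- `s_n(k,m)`: the sum, over the same pairs `(σ, τ)` as in `s1Count`, of `a` raised to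
the number of vertices of the lower path `σ` with second coordinate `0`. -/
noncomputable def sW (a : ℝ) (n k m : ℕ) : ℝ :=
  ∑ p ∈ (Finset.univ : Finset ((Fin n → Bool) × (Fin n → Bool))).filter
      (fun p => InUHP 0 p.1 ∧ InUHP 2 p.2 ∧ (∀ i ≤ n, hgt 0 p.1 i < hgt 2 p.2 i) ∧
        hgt 0 p.1 n = (m : ℤ) ∧ hgt 2 p.2 n = (k : ℤ) + 2),
    a ^ visits 0 p.1

/-- `P^{G2}_{2n}(a,y) = Σ_{k=0}^{(n-2)/2} Σ_{m=1}^{k} (s_{(n-2)/2}(k,m))² y^{k+2}`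
(for even `n`). -/
noncomputable def PG2 (n : ℕ) (a y : ℝ) : ℝ :=
  ∑ k ∈ Finset.range ((n - 2) / 2 + 1), ∑ m ∈ Finset.Icc 1 k,
    (sW a ((n - 2) / 2) k m) ^ 2 * y ^ (k + 2)



/-- extended weighted pair sum, with integer end heights -/
noncomputable def sG (a : ℝ) (n : ℕ) (x y : ℤ) : ℝ :=
  ∑ p : (Fin n → Bool) × (Fin n → Bool),
    if (InUHP 0 p.1 ∧ InUHP 2 p.2 ∧ (∀ i ≤ n, hgt 0 p.1 i < hgt 2 p.2 i) ∧
        hgt 0 p.1 n = x ∧ hgt 2 p.2 n = y) then a ^ visits 0 p.1 else 0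

lemma sW_eq_sG (a : ℝ) (n k m : ℕ) : sW a n k m = sG a n m (k + 2) := by
  unfold sW sG
  rw [Finset.sum_filter]

lemma hgt_snoc_le {n : ℕ} (c : ℤ) (s : Fin n → Bool) (b : Bool) (i : ℕ) (hi : i ≤ n) :
    hgt c (Fin.snoc s b : Fin (n+1) → Bool) i = hgt c s i := by
  unfold hgt
  congr 1
  apply Finset.sum_congr rfl
  intro j hj
  have hj' : j < n := by have := Finset.mem_range.1 hj; omega
  have : (⟨j, by omega⟩ : Fin (n+1)) = Fin.castSucc ⟨j, hj'⟩ := rfl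
  rw [dif_pos hj', dif_pos (by omega), this, Fin.snoc_castSucc]

lemma hgt_snoc_last {n : ℕ} (c : ℤ) (s : Fin n → Bool) (b : Bool) :
    hgt c (Fin.snoc s b : Fin (n+1) → Bool) (n+1) = hgt c s n + (if b then 1 else -1) := by
  rw [← hgt_snoc_le c s b n le_rfl]
  unfold hgt
  rw [Finset.sum_range_succ, dif_pos (by omega), ← add_assoc]
  have : (⟨n, by omega⟩ : Fin (n+1)) = Fin.last n := rfl
  rw [this, Fin.snoc_last]

lemma visits_snoc {n : ℕ} (c : ℤ) (s : Fin n → Bool) (b : Bool) :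
    visits c (Fin.snoc s b : Fin (n+1) → Bool)
      = visits c s + if hgt c s n + (if b then 1 else -1) = 0 then 1 else 0 := by
  unfold visits
  rw [Finset.range_add_one, Finset.filter_insert, hgt_snoc_last]
  have : (Finset.range (n+1)).filter (fun i => hgt c (Fin.snoc s b : Fin (n+1) → Bool) i = 0)
      = (Finset.range (n+1)).filter (fun i => hgt c s i = 0) := by
    apply Finset.filter_congr
    intro i hi
    rw [hgt_snoc_le c s b i (by have := Finset.mem_range.1 hi; omega)]
  rw [this]
  split_ifs <;> simp

lemma InUHP_snoc {n : ℕ} (c : ℤ) (s : Fin n → Bool) (b : Bool) :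
    InUHP c (Fin.snoc s b : Fin (n+1) → Bool)
      ↔ InUHP c s ∧ 0 ≤ hgt c s n + (if b then 1 else -1) := by
  unfold InUHP
  constructor
  · intro h
    refine ⟨fun i hi => ?_, ?_⟩
    · rw [← hgt_snoc_le c s b i hi]; exact h i (by omega)
    · rw [← hgt_snoc_last]; exact h _ le_rfl
  · rintro ⟨h1, h2⟩ i hi
    rcases Nat.lt_or_ge n i with h | h
    · obtain rfl : i = n + 1 := by omega
      rw [hgt_snoc_last]; exact h2
    · rw [hgt_snoc_le c s b i h]; exact h1 i h

lemma lt_snoc {n : ℕ} (c d : ℤ) (s t : Fin n → Bool) (b e : Bool) :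
    (∀ i ≤ n+1, hgt c (Fin.snoc s b : Fin (n+1) → Bool) i < hgt d (Fin.snoc t e : Fin (n+1) → Bool) i)
      ↔ (∀ i ≤ n, hgt c s i < hgt d t i) ∧
        hgt c s n + (if b then 1 else -1) < hgt d t n + (if e then 1 else -1) := by
  constructor
  · intro h
    refine ⟨fun i hi => ?_, ?_⟩
    · rw [← hgt_snoc_le c s b i hi, ← hgt_snoc_le d t e i hi]; exact h i (by omega)
    · rw [← hgt_snoc_last, ← hgt_snoc_last]; exact h _ le_rfl
  · rintro ⟨h1, h2⟩ i hi
    rcases Nat.lt_or_ge n i with h | h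
    · obtain rfl : i = n + 1 := by omega
      rw [hgt_snoc_last, hgt_snoc_last]; exact h2
    · rw [hgt_snoc_le c s b i h, hgt_snoc_le d t e i h]; exact h1 i h

lemma sum_snoc {n : ℕ} (f : (Fin (n+1) → Bool) → ℝ) :
    ∑ s, f s = ∑ s : Fin n → Bool, (f (Fin.snoc s true) + f (Fin.snoc s false)) := by
  rw [← (Fin.snocEquiv (fun _ : Fin (n+1) => Bool)).sum_comp, Fintype.sum_prod_type_right]
  simp [Fin.snocEquiv]

lemma sG_zero_of_not (a : ℝ) (n : ℕ) (x y : ℤ) (h : ¬ (0 ≤ x ∧ x < y)) : sG a n x y = 0 := by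
  unfold sG
  apply Finset.sum_eq_zero
  rintro p -
  rw [if_neg]
  rintro ⟨h1, h2, h3, h4, h5⟩
  apply h
  rw [← h4, ← h5]
  exact ⟨h1 n le_rfl, h3 n le_rfl⟩

lemma sG_succ (a : ℝ) (n : ℕ) (x y : ℤ) (hx : 0 ≤ x) (hxy : x < y) :
    sG a (n+1) x y = (if x = 0 then a else 1) *
      (sG a n (x-1) (y-1) + sG a n (x-1) (y+1) + sG a n (x+1) (y-1) + sG a n (x+1) (y+1)) := by
  unfold sG
  rw [Fintype.sum_prod_type, sum_snoc]
  simp_rw [sum_snoc]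
  simp_rw [Fintype.sum_prod_type]
  rw [← Finset.sum_add_distrib, ← Finset.sum_add_distrib, ← Finset.sum_add_distrib, Finset.mul_sum]
  apply Finset.sum_congr rfl
  intro s _
  simp only [← Finset.sum_add_distrib]
  rw [Finset.mul_sum]
  apply Finset.sum_congr rfl
  intro t _
  simp only [InUHP_snoc, lt_snoc, hgt_snoc_last, visits_snoc]
  have key : ∀ b e : ℤ,
      (if ((InUHP 0 s ∧ 0 ≤ hgt 0 s n + b) ∧ (InUHP 2 t ∧ 0 ≤ hgt 2 t n + e) ∧
        ((∀ i ≤ n, hgt 0 s i < hgt 2 t i) ∧ hgt 0 s n + b < hgt 2 t n + e) ∧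
        hgt 0 s n + b = x ∧ hgt 2 t n + e = y)
        then a ^ (visits 0 s + if hgt 0 s n + b = 0 then 1 else 0) else 0)
      = (if x = 0 then a else 1) * (if (InUHP 0 s ∧ InUHP 2 t ∧ (∀ i ≤ n, hgt 0 s i < hgt 2 t i) ∧
        hgt 0 s n = x - b ∧ hgt 2 t n = y - e) then a ^ visits 0 s else 0) := by
    intro b e
    by_cases h : (InUHP 0 s ∧ InUHP 2 t ∧ (∀ i ≤ n, hgt 0 s i < hgt 2 t i) ∧
        hgt 0 s n = x - b ∧ hgt 2 t n = y - e)
    · obtain ⟨h1, h2, h3, h4, h5⟩ := h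
      have c1 : InUHP 0 s ∧ InUHP 2 t ∧ (∀ i ≤ n, hgt 0 s i < hgt 2 t i) ∧
        hgt 0 s n = x - b ∧ hgt 2 t n = y - e := ⟨h1, h2, h3, h4, h5⟩
      have c2 : (InUHP 0 s ∧ 0 ≤ hgt 0 s n + b) ∧ (InUHP 2 t ∧ 0 ≤ hgt 2 t n + e) ∧
        ((∀ i ≤ n, hgt 0 s i < hgt 2 t i) ∧ hgt 0 s n + b < hgt 2 t n + e) ∧
        hgt 0 s n + b = x ∧ hgt 2 t n + e = y :=
        ⟨⟨h1, by omega⟩, ⟨h2, by omega⟩, ⟨h3, by omega⟩, by omega, by omega⟩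
      have c3 : hgt 0 s n + b = x := by omega
      rw [if_pos c1, if_pos c2, c3, pow_add]
      split_ifs <;> ring
    · rw [if_neg h, if_neg, mul_zero]
      rintro ⟨⟨h1, _⟩, ⟨h2, _⟩, ⟨h3, _⟩, h4, h5⟩
      exact h ⟨h1, h2, h3, by omega, by omega⟩
  have k1 := key 1 1
  have k2 := key 1 (-1)
  have k3 := key (-1) 1
  have k4 := key (-1) (-1)
  simp only [sub_neg_eq_add] at k1 k2 k3 k4
  simp only [if_true, Bool.false_eq_true, if_false]
  rw [k1, k2, k3, k4]
  ring

lemma sG_base (a : ℝ) (x y : ℤ) : sG a 0 x y = if (x = 0 ∧ y = 2) then a else 0 := by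
  unfold sG
  rw [Fintype.sum_prod_type, Fintype.sum_unique, Fintype.sum_unique]
  have h1 : ∀ (c : ℤ) (s : Fin 0 → Bool), hgt c s 0 = c := by intro c s; simp [hgt]
  have h2 : ∀ (c : ℤ) (s : Fin 0 → Bool), visits c s = if c = 0 then 1 else 0 := by
    intro c s
    simp only [visits, zero_add, Finset.range_one, Finset.filter_singleton, h1]
    split_ifs <;> simp
  simp [InUHP, h1, h2, eq_comm]

/-- weighted single-path evolution with initial condition `f` -/
noncomputable def ZZ (a : ℝ) (f : ℤ → ℝ) : ℕ → ℤ → ℝ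
  | 0 => f
  | (n+1) => fun x => if x < 0 then 0 else
      (if x = 0 then a else 1) * (ZZ a f n (x-1) + ZZ a f n (x+1))

noncomputable def f0 (a : ℝ) : ℤ → ℝ := fun x => if x = 0 then a else 0
noncomputable def f2 : ℤ → ℝ := fun x => if x = 2 then 1 else 0

lemma ZZ_neg (a : ℝ) (f : ℤ → ℝ) (hf : ∀ x < 0, f x = 0) (n : ℕ) (x : ℤ) (hx : x < 0) :
    ZZ a f n x = 0 := by
  cases n with
  | zero => exact hf x hx
  | succ n => simp [ZZ, hx]

lemma ZZ_parity (a : ℝ) (f : ℤ → ℝ) (hf : ∀ x, x % 2 ≠ 0 → f x = 0) (n : ℕ) :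
    ∀ x : ℤ, (x - n) % 2 ≠ 0 → ZZ a f n x = 0 := by
  induction n with
  | zero => intro x hx; exact hf x (by simpa using hx)
  | succ n ih =>
    intro x hx
    push_cast at hx
    simp only [ZZ]
    rw [ih (x-1) (by omega), ih (x+1) (by omega)]
    simp

lemma f0_neg (a : ℝ) : ∀ x < 0, f0 a x = 0 := by
  intro x hx; simp [f0]; omega
lemma f2_neg : ∀ x < 0, f2 x = 0 := by
  intro x hx; simp [f2]; omega
lemma f0_par (a : ℝ) : ∀ x, x % 2 ≠ 0 → f0 a x = 0 := by
  intro x hx; unfold f0; rw [if_neg]; omega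
lemma f2_par : ∀ x, x % 2 ≠ 0 → f2 x = 0 := by
  intro x hx; unfold f2; rw [if_neg]; omega

lemma sG_eq_det (a : ℝ) (n : ℕ) : ∀ x y : ℤ, 0 ≤ x → x < y →
    sG a n x y = ZZ a (f0 a) n x * ZZ a f2 n y - ZZ a (f0 a) n y * ZZ a f2 n x := by
  induction n with
  | zero =>
    intro x y hx hxy
    rw [sG_base]
    simp only [ZZ, f0, f2]
    have hy : y ≠ 0 := by omega
    by_cases h1 : x = 0 <;> by_cases h2 : y = 2 <;> simp [h1, h2, hy]
  | succ n ih =>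
    intro x y hx hxy
    rw [sG_succ a n x y hx hxy]
    have key : ∀ x' y' : ℤ, -1 ≤ x' → (x' < y' ∨ x' = y' ∨ (x' - y') % 2 ≠ 0) →
      sG a n x' y' = ZZ a (f0 a) n x' * ZZ a f2 n y' - ZZ a (f0 a) n y' * ZZ a f2 n x' := by
      intro x' y' h1 h2
      by_cases h : 0 ≤ x' ∧ x' < y'
      · exact ih x' y' h.1 h.2
      · rw [sG_zero_of_not a n x' y' h]
        by_cases h3 : x' < 0
        · rw [ZZ_neg a _ (f0_neg a) n x' h3, ZZ_neg a _ f2_neg n x' h3]; ring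
        · by_cases h4 : x' = y'
          · rw [h4]; ring
          · have h5 : (x' - y') % 2 ≠ 0 := by omega
            by_cases h6 : (x' - n) % 2 = 0
            · rw [ZZ_parity a _ (f0_par a) n y' (by omega), ZZ_parity a _ f2_par n y' (by omega)]
              ring
            · rw [ZZ_parity a _ (f0_par a) n x' (by omega), ZZ_parity a _ f2_par n x' (by omega)]
              ring
    rw [key (x-1) (y-1) (by omega) (by omega), key (x-1) (y+1) (by omega) (by omega),
      key (x+1) (y-1) (by omega) (by omega), key (x+1) (y+1) (by omega) (by omega)]
    have hy0 : ¬ y < 0 := by omega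
    have hy1 : ¬ y = 0 := by omega
    have hx0 : ¬ x < 0 := by omega
    simp only [ZZ, hy0, hy1, hx0, if_false]
    ring

lemma ZZ_two (a : ℝ) (n : ℕ) : ∀ x : ℤ,
    ZZ a (f0 a) (n+2) x = a * (ZZ a (f0 a) n x + ZZ a f2 n x) := by
  induction n with
  | zero =>
    intro x
    simp only [ZZ, f0, f2]
    rcases lt_trichotomy x 0 with h | h | h
    · have h0 : x ≠ 0 := by omega
      have h2 : x ≠ 2 := by omega
      simp [h, h0, h2]
    · subst h; norm_num
    · have h1 : ¬ x < 0 := by omega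
      have h2 : x ≠ 0 := by omega
      have h3 : ¬ x - 1 < 0 := by omega
      have h4 : ¬ x + 1 < 0 := by omega
      have h5 : ¬ x + 1 = 0 := by omega
      have h6 : ¬ x - 1 + 1 = 0 := by omega
      have h7 : ¬ x + 1 + 1 = 0 := by omega
      have h8 : ¬ x + 1 - 1 = 0 := by omega
      simp only [h1, h2, h3, h4, h5, h6, h7, h8, if_false]
      by_cases h9 : x = 2
      · subst h9; norm_num
      · have h10 : ¬ x - 1 - 1 = 0 := by omega
        simp [h9, h10]
  | succ n ih =>
    intro x
    have e1 : ZZ a (f0 a) (n+1+2) x = if x < 0 then 0 else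
      (if x = 0 then a else 1) * (ZZ a (f0 a) (n+2) (x-1) + ZZ a (f0 a) (n+2) (x+1)) := rfl
    rw [e1, ih, ih]
    simp only [ZZ]
    split_ifs <;> ring

/-- The basic weighted count of paths from `0` to `x`. -/
noncomputable def AA (a : ℝ) (n : ℕ) (x : ℤ) : ℝ := ZZ a (f0 a) n x

lemma AA_succ (a : ℝ) (n : ℕ) (x : ℤ) (hx : 0 ≤ x) :
    AA a (n+1) x = (if x = 0 then a else 1) * (AA a n (x-1) + AA a n (x+1)) := by
  have : ¬ x < 0 := by omega
  simp [AA, ZZ, this]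

lemma AA_zero (a : ℝ) (x : ℤ) : AA a 0 x = if x = 0 then a else 0 := rfl

lemma AA_neg (a : ℝ) (n : ℕ) (x : ℤ) (hx : x < 0) : AA a n x = 0 := ZZ_neg a _ (f0_neg a) n x hx

lemma AA_par (a : ℝ) (n : ℕ) (x : ℤ) (hx : (x - n) % 2 ≠ 0) : AA a n x = 0 :=
  ZZ_parity a _ (f0_par a) n x hx

lemma AA_big (a : ℝ) (n : ℕ) : ∀ x : ℤ, (n : ℤ) < x → AA a n x = 0 := by
  induction n with
  | zero => intro x hx; rw [AA_zero, if_neg]; push_cast at hx; omega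
  | succ n ih =>
    intro x hx
    push_cast at hx
    rw [AA_succ a n x (by omega), ih _ (by omega), ih _ (by omega)]; simp

lemma sW_eq (a : ℝ) (ha : a ≠ 0) (n k m : ℕ) (hmk : m ≤ k) :
    sW a n k m = (1 / a) * (AA a n m * AA a (n+2) ((k + 2 : ℕ) : ℤ)
      - AA a n ((k + 2 : ℕ) : ℤ) * AA a (n+2) m) := by
  rw [sW_eq_sG, sG_eq_det a n _ _ (by omega) (by omega)]
  unfold AA
  rw [ZZ_two, ZZ_two]
  push_cast
  field_simp
  ring


noncomputable def wt (a : ℝ) (x : ℕ) : ℝ := if x = 0 then a else 1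

lemma wt_ne (a : ℝ) (ha : a ≠ 0) (x : ℕ) : wt a x ≠ 0 := by
  unfold wt; split_ifs <;> simp [ha]

lemma by_parts (u v : ℤ → ℝ) (hu : u (-1) = 0) (hv : v (-1) = 0) (L : ℕ) :
    ∑ x ∈ range L, (u ((x:ℤ) - 1) + u (x + 1)) * v x
      - ∑ x ∈ range L, u x * (v ((x:ℤ) - 1) + v (x + 1))
      = u L * v ((L:ℤ) - 1) - u ((L:ℤ) - 1) * v L := by
  induction L with
  | zero => simp [hu, hv]
  | succ L ih =>
    rw [Finset.sum_range_succ, Finset.sum_range_succ]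
    push_cast
    have e : (L : ℤ) + 1 - 1 = L := by ring
    rw [e]
    linear_combination ih

lemma AA_succ_div (a : ℝ) (ha : a ≠ 0) (n : ℕ) (x : ℕ) :
    AA a (n+1) x / wt a x = AA a n ((x:ℤ)-1) + AA a n (x+1) := by
  rw [AA_succ a n x (by omega)]
  have : (if (x:ℤ) = 0 then a else 1) = wt a x := by simp [wt]
  rw [this]
  field_simp [wt_ne a ha x]

lemma gram_step (a : ℝ) (ha : a ≠ 0) (n m L : ℕ) (hn : n < L) (hm : m < L) :
    ∑ x ∈ range L, AA a (n+1) x * AA a m x / wt a x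
      = ∑ x ∈ range L, AA a n x * AA a (m+1) x / wt a x := by
  have h := by_parts (AA a n) (AA a m) (AA_neg a n _ (by omega)) (AA_neg a m _ (by omega)) L
  rw [AA_big a n L (by omega), AA_big a m L (by omega)] at h
  have e1 : ∑ x ∈ range L, AA a (n+1) x * AA a m x / wt a x
      = ∑ x ∈ range L, (AA a n ((x:ℤ) - 1) + AA a n (x + 1)) * AA a m x := by
    apply Finset.sum_congr rfl
    intro x _
    rw [← AA_succ_div a ha]; ring
  have e2 : ∑ x ∈ range L, AA a n x * AA a (m+1) x / wt a x
      = ∑ x ∈ range L, AA a n x * (AA a m ((x:ℤ) - 1) + AA a m (x + 1)) := by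
    apply Finset.sum_congr rfl
    intro x _
    rw [← AA_succ_div a ha]; ring
  rw [e1, e2]
  linarith

lemma gram_aux (a : ℝ) (ha : a ≠ 0) (m : ℕ) : ∀ n L : ℕ, n + m < L →
    ∑ x ∈ range L, AA a n x * AA a m x / wt a x = AA a (n+m) 0 := by
  induction m with
  | zero =>
    intro n L hL
    rw [Finset.sum_eq_single 0]
    · simp [AA_zero, wt, ha]
    · intro b _ hb
      rw [AA_zero, if_neg (by exact_mod_cast hb)]; simp
    · intro h; simp at h; omega
  | succ m ih =>
    intro n L hL
    rw [← gram_step a ha n m L (by omega) (by omega), ih (n+1) L (by omega)]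
    congr 1; omega

lemma gram (a : ℝ) (ha : a ≠ 0) (m n L : ℕ) (h : n < L) :
    ∑ x ∈ range L, AA a n x * AA a m x / wt a x = AA a (n+m) 0 := by
  rw [← gram_aux a ha m n (L + m) (by omega)]
  apply Finset.sum_subset
  · intro x; simp; omega
  · intro x _ hx
    simp at hx
    rw [AA_big a n x (by omega)]; simp

lemma gram_pos (a : ℝ) (ha : a ≠ 0) (m n M : ℕ) (h : n ≤ M) :
    ∑ x ∈ Icc 1 M, AA a n (x:ℤ) * AA a m (x:ℤ) = AA a (n+m) 0 - AA a n 0 * AA a m 0 / a := by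
  rw [← gram a ha m n (M+1) (by omega), Finset.range_eq_Ico,
    Finset.sum_eq_sum_Ico_succ_bot (by omega)]
  have : ∑ x ∈ Ico (0+1) (M+1), AA a n x * AA a m x / wt a x
      = ∑ x ∈ Icc 1 M, AA a n (x:ℤ) * AA a m (x:ℤ) := by
    have e : Ico (0+1) (M+1) = Icc 1 M := by ext x; simp only [mem_Ico, mem_Icc]; omega
    rw [e]
    apply Finset.sum_congr rfl
    intro x hx
    have : x ≠ 0 := by simp at hx; omega
    simp [wt, this]
  rw [this]
  simp [wt]

lemma sum_sym (h : ℕ → ℕ → ℝ) (hs : ∀ x y, h x y = h y x) (h0 : ∀ x, h x x = 0)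
    (h1 : ∀ x, h x (x+1) = 0) (K : ℕ) :
    ∑ x ∈ Icc 1 (K+1), ∑ y ∈ Icc 1 (K+1), h x y
      = 2 * ∑ k ∈ range K, ∑ m ∈ Icc 1 k, h m (k+2) := by
  induction K with
  | zero => simp [h0]
  | succ K ih =>
    rw [Finset.sum_range_succ, mul_add, ← ih]
    rw [← Finset.insert_Icc_right_eq_Icc_add_one (by omega), Finset.sum_insert (by simp)]
    simp_rw [Finset.sum_insert (show K + 1 + 1 ∉ Icc 1 (K+1) by simp)]
    rw [Finset.sum_add_distrib, h0]
    have e : ∑ x ∈ Icc 1 (K+1), h x (K+1+1) = ∑ x ∈ Icc 1 K, h x (K+2) := by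
      rw [← Finset.insert_Icc_right_eq_Icc_add_one (by omega), Finset.sum_insert (by simp), h1]
      simp
    have e2 : ∑ x ∈ Icc 1 (K+1), h (K+1+1) x = ∑ x ∈ Icc 1 K, h x (K+2) := by
      rw [← e]; exact Finset.sum_congr rfl (fun x _ => hs _ _)
    rw [e, e2]; ring

lemma lagrange (s : Finset ℕ) (u v : ℕ → ℝ) :
    ∑ x ∈ s, ∑ y ∈ s, (u x * v y - u y * v x) ^ 2
      = 2 * ((∑ x ∈ s, u x * u x) * (∑ x ∈ s, v x * v x) - (∑ x ∈ s, u x * v x) ^ 2) := by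
  have : ∀ x y, (u x * v y - u y * v x) ^ 2
      = (u x * u x) * (v y * v y) + (v x * v x) * (u y * u y)
        - 2 * ((u x * v x) * (u y * v y)) := by intros; ring
  simp_rw [this, Finset.sum_sub_distrib, Finset.sum_add_distrib, ← Finset.mul_sum,
    ← Finset.sum_mul]
  ring

lemma PG2_formula (a : ℝ) (ha : a ≠ 0) (N : ℕ) :
    a ^ 2 * PG2 (2 * (N + 1)) a 1
      = (AA a (2*N) 0 - AA a N 0 ^ 2 / a) * (AA a (2*N+4) 0 - AA a (N+2) 0 ^ 2 / a)
        - (AA a (2*N+2) 0 - AA a N 0 * AA a (N+2) 0 / a) ^ 2 := by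
  have hN : (2 * (N+1) - 2) / 2 = N := by omega
  unfold PG2
  rw [hN]
  set h : ℕ → ℕ → ℝ := fun x y => (AA a N (x:ℤ) * AA a (N+2) (y:ℤ)
      - AA a N (y:ℤ) * AA a (N+2) (x:ℤ)) ^ 2 with hh
  have e1 : ∑ k ∈ range (N+1), ∑ m ∈ Icc 1 k, (sW a N k m) ^ 2 * (1:ℝ) ^ (k+2)
      = (1 / a ^ 2) * ∑ k ∈ range (N+1), ∑ m ∈ Icc 1 k, h m (k+2) := by
    simp_rw [Finset.mul_sum]
    apply Finset.sum_congr rfl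
    intro k _
    apply Finset.sum_congr rfl
    intro m hm
    rw [sW_eq a ha N k m (by simp at hm; omega), hh]
    simp only [one_pow, mul_one]
    rw [mul_pow]; congr 1; simp
  have e2 := sum_sym h (by intro x y; simp only [hh]; ring) (by intro x; simp only [hh]; ring)
    (by
      intro x
      simp only [hh]
      by_cases hp : ((x:ℤ) - N) % 2 = 0
      · rw [AA_par a N ((x+1 : ℕ):ℤ) (by push_cast; omega),
          AA_par a (N+2) ((x+1 : ℕ):ℤ) (by push_cast; omega)]; ring
      · rw [AA_par a N (x:ℤ) (by omega),
          AA_par a (N+2) (x:ℤ) (by push_cast; omega)]; ring) (N+1)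
  have e3 := lagrange (Icc 1 (N+1+1)) (fun x => AA a N (x:ℤ)) (fun x => AA a (N+2) (x:ℤ))
  rw [gram_pos a ha N N (N+1+1) (by omega), gram_pos a ha (N+2) (N+2) (N+1+1) (by omega),
    gram_pos a ha (N+2) N (N+1+1) (by omega)] at e3
  have e4 : ∑ k ∈ range (N+1), ∑ m ∈ Icc 1 k, h m (k+2) = (AA a (N+N) 0 - AA a N 0 * AA a N 0 / a)
      * (AA a (N+2+(N+2)) 0 - AA a (N+2) 0 * AA a (N+2) 0 / a)
        - (AA a (N+(N+2)) 0 - AA a N 0 * AA a (N+2) 0 / a) ^ 2 := by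
    have : (2:ℝ) ≠ 0 := by norm_num
    apply mul_left_cancel₀ this
    rw [← e2, ← e3]
  rw [e1, e4]
  have t1 : N + N = 2 * N := by ring
  have t2 : N + 2 + (N + 2) = 2 * N + 4 := by ring
  have t3 : N + (N + 2) = 2 * N + 2 := by ring
  rw [t1, t2, t3]
  field_simp


noncomputable def bet (n : ℕ) (x : ℤ) : ℝ :=
  (2 / Real.pi) * ∫ t in (0:ℝ)..Real.pi,
    (2 * Real.cos t) ^ n * (Real.sin ((x + 1) * t) * Real.sin t)

lemma bet_succ (n : ℕ) (x : ℤ) : bet (n+1) x = bet n (x-1) + bet n (x+1) := by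
  unfold bet
  rw [← mul_add, ← intervalIntegral.integral_add]
  · congr 1
    apply intervalIntegral.integral_congr
    intro t _
    simp only
    push_cast
    have e1 : ((x:ℝ) - 1 + 1) * t = (x+1) * t - t := by ring
    have e2 : ((x:ℝ) + 1 + 1) * t = (x+1) * t + t := by ring
    rw [e1, e2, Real.sin_sub, Real.sin_add]
    ring
  · apply Continuous.intervalIntegrable; fun_prop
  · apply Continuous.intervalIntegrable; fun_prop

lemma bet_neg (n : ℕ) : bet n (-1) = 0 := by
  simp [bet]

lemma int_cos_int (c : ℤ) : ∫ t in (0:ℝ)..Real.pi, Real.cos (c * t) = if c = 0 then Real.pi else 0 := by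
  split_ifs with h
  · simp [h]
  · have hc : (c:ℝ) ≠ 0 := by exact_mod_cast h
    rw [intervalIntegral.integral_comp_mul_left (fun t => Real.cos t) hc]
    simp [Real.sin_int_mul_pi]

lemma bet_base (x : ℤ) (hx : 0 ≤ x) : bet 0 x = if x = 0 then 1 else 0 := by
  unfold bet
  have e : ∀ t : ℝ, (2 * Real.cos t) ^ 0 * (Real.sin ((x + 1) * t) * Real.sin t)
      = (1/2) * Real.cos (x * t) - (1/2) * Real.cos (((x + 2 : ℤ) : ℝ) * t) := by
    intro t
    have e1 : (x:ℝ) * t = (x+1) * t - t := by ring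
    have e2 : ((x + 2 : ℤ) : ℝ) * t = (x+1) * t + t := by push_cast; ring
    rw [e1, e2, Real.cos_sub, Real.cos_add]
    ring
  simp_rw [e]
  rw [intervalIntegral.integral_sub, intervalIntegral.integral_const_mul,
    intervalIntegral.integral_const_mul, int_cos_int, int_cos_int]
  · have : x + 2 ≠ 0 := by omega
    have hpi := Real.pi_ne_zero
    simp only [this, if_false]
    split_ifs
    · field_simp; norm_num
    · simp
  · apply Continuous.intervalIntegrable; fun_prop
  · apply Continuous.intervalIntegrable; fun_prop

lemma AA_bet (a : ℝ) (n : ℕ) : ∀ x : ℤ, 0 ≤ x →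
    AA a n x - (a - 1) * AA a n (x + 2) = a * bet n x := by
  induction n with
  | zero =>
    intro x hx
    rw [bet_base x hx, AA_zero, AA_zero]
    have : x + 2 ≠ 0 := by omega
    simp [this]
  | succ n ih =>
    intro x hx
    rw [bet_succ, AA_succ a n x hx, AA_succ a n (x+2) (by omega)]
    have h2 : x + 2 ≠ 0 := by omega
    have h3 := ih (x+1) (by omega)
    have e1 : x + 2 - 1 = x + 1 := by ring
    have e2 : x + 2 + 1 = x + 1 + 2 := by ring
    rw [e1, e2]
    simp only [h2, if_false]
    by_cases h0 : x = 0
    · subst h0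
      have h4 : AA a n (0 - 1) = 0 := AA_neg a n _ (by omega)
      have h5 : bet n (0 - 1) = 0 := bet_neg n
      rw [h4, h5]
      simp only [if_true]
      linear_combination h3
    · have h6 := ih (x-1) (by omega)
      have e3 : x - 1 + 2 = x + 1 := by ring
      rw [e3] at h6
      simp only [h0, if_false]
      linear_combination h3 + h6

lemma AA_series (a : ℝ) (n J : ℕ) :
    AA a n 0 = a * ∑ j ∈ range J, (a-1) ^ j * bet n (2 * j) + (a-1) ^ J * AA a n (2 * J) := by
  induction J with
  | zero => simp
  | succ J ih =>
    rw [ih, Finset.sum_range_succ]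
    have h := AA_bet a n (2 * J) (by omega)
    have e : (2 * ((J + 1 : ℕ) : ℤ)) = 2 * J + 2 := by push_cast; ring
    rw [e]
    linear_combination (a-1)^J * h

noncomputable def SJ (a : ℝ) (J : ℕ) (t : ℝ) : ℝ :=
  ∑ j ∈ range J, (a-1) ^ j * Real.sin ((2 * j + 1) * t)

noncomputable def DD (a t : ℝ) : ℝ := (2 - a) ^ 2 * Real.cos t ^ 2 + a ^ 2 * Real.sin t ^ 2

lemma DD_SJ (a : ℝ) (J : ℕ) (t : ℝ) : DD a t * SJ a J t = a * Real.sin t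
    - (a-1) ^ J * (Real.sin ((2 * J + 1) * t) - (a-1) * Real.sin ((2 * J - 1) * t)) := by
  induction J with
  | zero => simp [SJ]; ring
  | succ J ih =>
    unfold SJ at ih ⊢
    rw [Finset.sum_range_succ, mul_add, ih]
    push_cast
    have e1 : (2 * ((J:ℝ) + 1) + 1) * t = (2 * J + 1) * t + 2 * t := by ring
    have e2 : (2 * ((J:ℝ) + 1) - 1) * t = (2 * J + 1) * t := by ring
    have e3 : (2 * (J:ℝ) - 1) * t = (2 * J + 1) * t - 2 * t := by ring
    rw [e1, e2, e3, Real.sin_add, Real.sin_sub, Real.cos_two_mul, Real.sin_two_mul]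
    unfold DD
    rw [Real.sin_sq t]
    ring

lemma AA_int_SJ (a : ℝ) (n J : ℕ) (hJ : n < J) :
    AA a n 0 = (2 * a / Real.pi) * ∫ t in (0:ℝ)..Real.pi,
      (2 * Real.cos t) ^ n * (SJ a J t * Real.sin t) := by
  rw [AA_series a n J, AA_big a n (2 * J) (by omega)]
  have : ∀ t : ℝ, (2 * Real.cos t) ^ n * (SJ a J t * Real.sin t)
      = ∑ j ∈ range J, (a-1)^j * ((2 * Real.cos t) ^ n *
          (Real.sin (((2 * j : ℤ) + 1) * t) * Real.sin t)) := by
    intro t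
    unfold SJ
    rw [Finset.sum_mul, Finset.mul_sum]
    apply Finset.sum_congr rfl
    intro j _
    push_cast
    ring
  simp_rw [this]
  rw [intervalIntegral.integral_finsetSum]
  · simp_rw [intervalIntegral.integral_const_mul]
    simp only [mul_zero, add_zero]
    rw [Finset.mul_sum, Finset.mul_sum]
    apply Finset.sum_congr rfl
    intro j _
    unfold bet
    push_cast
    ring
  · intro j _
    apply Continuous.intervalIntegrable; fun_prop

noncomputable def del (a : ℝ) : ℝ := min ((2 - a) ^ 2) (a ^ 2)

lemma del_pos (a : ℝ) (ha : 0 < a) (ha2 : a < 2) : 0 < del a := by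
  unfold del
  have : 0 < 2 - a := by linarith
  exact lt_min (by positivity) (by positivity)

lemma del_le (a t : ℝ) : del a ≤ DD a t := by
  unfold DD del
  have h1 : min ((2 - a) ^ 2) (a ^ 2) ≤ (2-a)^2 := min_le_left _ _
  have h2 : min ((2 - a) ^ 2) (a ^ 2) ≤ a^2 := min_le_right _ _
  have h3 := Real.sin_sq_add_cos_sq t
  nlinarith [mul_le_mul_of_nonneg_right h1 (sq_nonneg (Real.cos t)),
    mul_le_mul_of_nonneg_right h2 (sq_nonneg (Real.sin t))]

lemma DD_cont (a : ℝ) : Continuous (DD a) := by unfold DD; fun_prop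

lemma SJ_cont (a : ℝ) (J : ℕ) : Continuous (SJ a J) := by unfold SJ; fun_prop

lemma SJ_bound (a : ℝ) (ha : 0 < a) (ha2 : a < 2) (J : ℕ) (t : ℝ) :
    |SJ a J t - a * Real.sin t / DD a t| ≤ 2 / del a * |a - 1| ^ J := by
  have hd := del_pos a ha ha2
  have hD := del_le a t
  have hDp : 0 < DD a t := by linarith
  have e : SJ a J t - a * Real.sin t / DD a t = - ((a-1) ^ J * (Real.sin ((2 * J + 1) * t)
      - (a-1) * Real.sin ((2 * J - 1) * t))) / DD a t := by
    have := DD_SJ a J t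
    rw [eq_div_iff hDp.ne', sub_mul, div_mul_cancel₀ _ hDp.ne']
    linear_combination this
  rw [e, abs_div, abs_neg, abs_mul, abs_pow, abs_of_pos hDp]
  have h1 : |Real.sin ((2 * J + 1) * t) - (a-1) * Real.sin ((2 * J - 1) * t)| ≤ 2 := by
    have i1 := Real.abs_sin_le_one ((2 * J + 1) * t)
    have i2 := Real.abs_sin_le_one ((2 * J - 1) * t)
    have i3 : |a - 1| ≤ 1 := by rw [abs_le]; constructor <;> linarith
    calc _ ≤ |Real.sin ((2 * J + 1) * t)| + |(a-1) * Real.sin ((2 * J - 1) * t)| := abs_sub _ _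
      _ ≤ 1 + 1 * 1 := by
        rw [abs_mul]; gcongr
      _ = 2 := by norm_num
  calc |a - 1| ^ J * |Real.sin ((2 * J + 1) * t) - (a-1) * Real.sin ((2 * J - 1) * t)| / DD a t
      ≤ |a-1|^J * 2 / del a := by gcongr
    _ = _ := by ring

/-- Integral representation of the return weights. -/
lemma AA_int (a : ℝ) (ha : 0 < a) (ha2 : a < 2) (n : ℕ) :
    AA a n 0 = (2 * a / Real.pi) * ∫ t in (0:ℝ)..Real.pi,
      (2 * Real.cos t) ^ n * (a * Real.sin t / DD a t * Real.sin t) := by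
  have hd := del_pos a ha ha2
  have hne : ∀ t, DD a t ≠ 0 := fun t => by have := del_le a t; linarith
  have hc := DD_cont a
  set G := (2 * a / Real.pi) * ∫ t in (0:ℝ)..Real.pi,
      (2 * Real.cos t) ^ n * (a * Real.sin t / DD a t * Real.sin t) with hG
  have key : ∀ J, n < J → |AA a n 0 - G| ≤
      (2 * a / Real.pi) * (2 ^ n * (2 / del a) * Real.pi) * |a-1| ^ J := by
    intro J hJ
    rw [AA_int_SJ a n J hJ, hG, ← mul_sub, ← intervalIntegral.integral_sub, abs_mul,
      abs_of_pos (show 0 < 2 * a / Real.pi by have := Real.pi_pos; positivity), mul_assoc]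
    · apply mul_le_mul_of_nonneg_left _ (by have := Real.pi_pos; positivity)
      have := intervalIntegral.norm_integral_le_of_norm_le_const
        (C := 2 ^ n * (2 / del a) * |a-1| ^ J) (a := 0) (b := Real.pi)
        (f := fun t => (2 * Real.cos t) ^ n * (SJ a J t * Real.sin t)
          - (2 * Real.cos t) ^ n * (a * Real.sin t / DD a t * Real.sin t)) (by
          intro t _
          have e : (2 * Real.cos t) ^ n * (SJ a J t * Real.sin t)
            - (2 * Real.cos t) ^ n * (a * Real.sin t / DD a t * Real.sin t)
            = (2 * Real.cos t) ^ n * ((SJ a J t - a * Real.sin t / DD a t) * Real.sin t) := by ring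
          rw [e, Real.norm_eq_abs, abs_mul, abs_mul, abs_pow, abs_mul]
          have i1 := Real.abs_sin_le_one t
          have i2 := Real.abs_cos_le_one t
          have i3 := SJ_bound a ha ha2 J t
          calc (|2| * |Real.cos t|) ^ n * (|SJ a J t - a * Real.sin t / DD a t| * |Real.sin t|)
              ≤ (2 * 1) ^ n * ((2 / del a * |a-1|^J) * 1) := by
                gcongr
                · simp
            _ = _ := by rw [mul_one, mul_one]; ring)
      rw [Real.norm_eq_abs, sub_zero, abs_of_pos Real.pi_pos] at this
      calc _ ≤ _ := this
        _ = _ := by ring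
    · apply Continuous.intervalIntegrable
      have := SJ_cont a J
      fun_prop
    · apply Continuous.intervalIntegrable
      fun_prop (disch := exact hne _)
  have hr : |a - 1| < 1 := by rw [abs_lt]; constructor <;> linarith
  have lim : Tendsto (fun J : ℕ => (2 * a / Real.pi) * (2 ^ n * (2 / del a) * Real.pi) * |a-1| ^ J)
      atTop (nhds 0) := by
    have := (tendsto_pow_atTop_nhds_zero_of_lt_one (abs_nonneg (a-1)) hr).const_mul
      ((2 * a / Real.pi) * (2 ^ n * (2 / del a) * Real.pi))
    simpa using this
  have h0 : |AA a n 0 - G| ≤ 0 := by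
    apply ge_of_tendsto lim
    filter_upwards [eventually_gt_atTop n] with J hJ
    exact key J hJ
  have := abs_nonpos_iff.1 h0
  linarith


noncomputable def II (N p : ℕ) : ℝ :=
  ∫ t in (0:ℝ)..Real.pi, Real.cos t ^ (2 * N) * Real.sin t ^ (2 * p)

noncomputable def EE (a : ℝ) (N i : ℕ) : ℝ :=
  ∫ t in (0:ℝ)..Real.pi, Real.cos t ^ (2 * N) * Real.sin t ^ (2 * (i + 1)) / DD a t

lemma II_sub (N p : ℕ) : II N (p+1) = II N p - II (N+1) p := by
  unfold II
  rw [← intervalIntegral.integral_sub]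
  · apply intervalIntegral.integral_congr
    intro t _
    simp only
    rw [mul_add, mul_add, pow_add, pow_add, mul_one, Real.sin_sq t]
    ring
  · apply Continuous.intervalIntegrable; fun_prop
  · apply Continuous.intervalIntegrable; fun_prop

lemma II_zero_succ (N : ℕ) : II (N+1) 0 = II N 0 * ((2 * N + 1) / (2 * N + 2)) := by
  unfold II
  have h := integral_cos_pow (a := 0) (b := Real.pi) (n := 2 * N)
  simp only [mul_zero, pow_zero, mul_one]
  rw [mul_add, mul_one, h]
  simp
  ring

lemma II_succ (p : ℕ) : ∀ N, II (N+1) p = II N p * ((2 * N + 1) / (2 * N + 2 * p + 2)) := by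
  induction p with
  | zero => intro N; rw [II_zero_succ]; simp
  | succ p ih =>
    intro N
    rw [II_sub, II_sub, ih (N+1), ih N]
    push_cast
    field_simp
    ring

lemma II_psucc (N p : ℕ) : II N (p+1) = II N p * ((2 * p + 1) / (2 * N + 2 * p + 2)) := by
  rw [II_sub, II_succ]
  field_simp
  ring

lemma II_zero_pos (N : ℕ) : 0 < II N 0 := by
  induction N with
  | zero => simp [II, Real.pi_pos]
  | succ N ih => rw [II_zero_succ]; positivity

lemma II_pos (N p : ℕ) : 0 < II N p := by
  induction p with
  | zero => exact II_zero_pos N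
  | succ p ih => rw [II_psucc]; positivity

lemma II_zero_le (N : ℕ) : II N 0 ≤ Real.pi := by
  induction N with
  | zero => simp [II]
  | succ N ih =>
    rw [II_zero_succ]
    have h : ((2 * N + 1 : ℝ) / (2 * N + 2)) ≤ 1 := by
      rw [div_le_one (by positivity)]; linarith
    have := II_zero_pos N
    nlinarith

lemma II_wallis (N : ℕ) : Real.Wallis.W N * (II N 0 ^ 2 * (2 * N + 1)) = Real.pi ^ 2 := by
  induction N with
  | zero => simp [II, Real.Wallis.W]
  | succ N ih =>
    rw [Real.Wallis.W_succ, II_zero_succ, ← ih]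
    push_cast
    field_simp
    ring

lemma tendsto_NJ : Tendsto (fun N : ℕ => (N:ℝ) * II N 0 ^ 2) atTop (nhds Real.pi) := by
  have h1 : ∀ N : ℕ, (N:ℝ) * II N 0 ^ 2
      = Real.pi ^ 2 / Real.Wallis.W N * ((N:ℝ) / (2 * N + 1)) := by
    intro N
    have := II_wallis N
    have hw := (Real.Wallis.W_pos N).ne'
    rw [← this]
    field_simp
  simp_rw [h1]
  have h2 : Tendsto (fun N : ℕ => ((N:ℝ) / (2 * N + 1))) atTop (nhds (1/2)) := by
    have e := tendsto_natCast_div_add_atTop (1/2 : ℝ)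
    have := e.const_mul (1/2 : ℝ)
    rw [mul_one] at this
    refine this.congr (fun N => ?_)
    field_simp
  have h3 := (tendsto_const_nhds (x := Real.pi ^ 2)).div Real.Wallis.tendsto_W_nhds_pi_div_two
    (by have := Real.pi_pos; positivity)
  have h4 := h3.mul h2
  have hpi := Real.pi_ne_zero
  have e : Real.pi ^ 2 / (Real.pi / 2) * (1 / 2) = Real.pi := by field_simp
  rw [e] at h4
  exact h4

lemma tendsto_g : Tendsto (fun N : ℕ => 1 / (((N:ℝ) + 1) * II N 0)) atTop (nhds 0) := by
  have h1 : Tendsto (fun N : ℕ => Real.sqrt (1 / ((N:ℝ) + 1))) atTop (nhds 0) := by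
    have := (Real.continuous_sqrt.tendsto 0).comp (tendsto_one_div_add_atTop_nhds_zero_nat (𝕜 := ℝ))
    rw [Real.sqrt_zero] at this
    exact this
  refine squeeze_zero (fun N => ?_) (fun N => ?_) h1
  · have := II_zero_pos N; positivity
  · have hJ := II_zero_pos N
    apply Real.le_sqrt_of_sq_le
    rw [div_pow, one_pow]
    apply one_div_le_one_div_of_le (by positivity)
    have hw := II_wallis N
    have hle := Real.Wallis.W_le N
    have hpi := Real.pi_gt_three
    have h3 : Real.pi ^ 2 ≤ Real.pi / 2 * (II N 0 ^ 2 * (2 * N + 1)) := by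
      rw [← hw]; gcongr
    have h4 : 2 * Real.pi ≤ II N 0 ^ 2 * (2 * N + 1) := by
      have : Real.pi * (2 * Real.pi) ≤ Real.pi * (II N 0 ^ 2 * (2 * N + 1)) := by nlinarith
      exact le_of_mul_le_mul_left this (by linarith)
    have h5 : 1 ≤ II N 0 ^ 2 * (N + 1) := by nlinarith [sq_nonneg (II N 0)]
    have : (0:ℝ) ≤ N + 1 := by positivity
    calc (N:ℝ) + 1 ≤ (N + 1) * (II N 0 ^ 2 * (N + 1)) := by nlinarith
      _ = _ := by ring

noncomputable def kap : ℕ → ℝ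
  | 0 => 1
  | (p+1) => kap p * ((2 * p + 1) / 2)

lemma tendsto_II (p : ℕ) :
    Tendsto (fun N : ℕ => (N:ℝ) ^ p * II N p / II N 0) atTop (nhds (kap p)) := by
  induction p with
  | zero =>
    refine tendsto_const_nhds.congr (fun N => ?_)
    have := (II_zero_pos N).ne'
    simp [kap, this]
  | succ p ih =>
    have e := (tendsto_natCast_div_add_atTop (p + 1 : ℝ)).mul_const ((2 * (p:ℝ) + 1) / 2)
    have := ih.mul e
    rw [one_mul] at this
    refine this.congr (fun N => ?_)
    have h0 := (II_zero_pos N).ne'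
    rw [II_psucc, pow_succ]
    have e2 : (2 * (N:ℝ) + 2 * p + 2) = 2 * (N + (p + 1)) := by ring
    rw [e2]
    field_simp

lemma EE_cont (a : ℝ) (ha : 0 < a) (ha2 : a < 2) (N i : ℕ) :
    Continuous (fun t => Real.cos t ^ (2 * N) * Real.sin t ^ (2 * (i + 1)) / DD a t) := by
  have hd := del_pos a ha ha2
  have hne : ∀ t, DD a t ≠ 0 := fun t => by have := del_le a t; linarith
  have hc := DD_cont a
  fun_prop (disch := exact hne _)

lemma EE_sub (a : ℝ) (ha : 0 < a) (ha2 : a < 2) (N i : ℕ) :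
    EE a (N+1) i = EE a N i - EE a N (i+1) := by
  unfold EE
  rw [← intervalIntegral.integral_sub]
  · apply intervalIntegral.integral_congr
    intro t _
    simp only
    have e1 : Real.cos t ^ (2 * (N + 1)) = Real.cos t ^ (2 * N) * (1 - Real.sin t ^ 2) := by
      rw [← Real.cos_sq']; ring
    rw [e1]
    ring
  · exact (EE_cont a ha ha2 _ _).intervalIntegrable _ _
  · exact (EE_cont a ha ha2 _ _).intervalIntegrable _ _

lemma AA_EE (a : ℝ) (ha : 0 < a) (ha2 : a < 2) (N : ℕ) :
    AA a (2 * N) 0 = 2 * a ^ 2 / Real.pi * 4 ^ N * EE a N 0 := by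
  rw [AA_int a ha ha2]
  unfold EE
  have : ∀ t, (2 * Real.cos t) ^ (2 * N) * (a * Real.sin t / DD a t * Real.sin t)
      = (a * 4 ^ N) * (Real.cos t ^ (2 * N) * Real.sin t ^ (2 * (0 + 1)) / DD a t) := by
    intro t
    rw [mul_pow, pow_mul 2 2 N]
    norm_num
    ring
  simp_rw [this]
  rw [intervalIntegral.integral_const_mul]
  ring

lemma EE_nonneg (a : ℝ) (ha : 0 < a) (ha2 : a < 2) (N i : ℕ) : 0 ≤ EE a N i := by
  unfold EE
  apply intervalIntegral.integral_nonneg Real.pi_pos.le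
  intro t _
  have hd := del_pos a ha ha2
  have := del_le a t
  have : 0 ≤ DD a t := by linarith
  rw [pow_mul, pow_mul]
  positivity

lemma EE_le (a : ℝ) (ha : 0 < a) (ha2 : a < 2) (N i : ℕ) :
    EE a N i ≤ (1 / del a) * II N (i+1) := by
  unfold EE II
  rw [← intervalIntegral.integral_const_mul]
  apply intervalIntegral.integral_mono_on Real.pi_pos.le
  · exact (EE_cont a ha ha2 _ _).intervalIntegrable _ _
  · apply Continuous.intervalIntegrable; fun_prop
  · intro t _
    have hd := del_pos a ha ha2
    have h1 := del_le a t
    have : 0 ≤ Real.cos t ^ (2 * N) * Real.sin t ^ (2 * (i + 1)) := by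
      rw [pow_mul, pow_mul]; positivity
    rw [div_eq_mul_one_div, mul_comm]
    gcongr

lemma EE_approx (a : ℝ) (ha : 0 < a) (ha2 : a < 2) (N i : ℕ) :
    |EE a N i - 1 / (2 - a) ^ 2 * II N (i+1)|
      ≤ (|4 - 4 * a| / (del a * (2 - a) ^ 2)) * II N (i+2) := by
  have hd := del_pos a ha ha2
  have h2a : 0 < 2 - a := by linarith
  unfold EE II
  rw [← intervalIntegral.integral_const_mul, ← intervalIntegral.integral_const_mul,
    ← intervalIntegral.integral_sub]
  · apply (intervalIntegral.abs_integral_le_integral_abs Real.pi_pos.le).trans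
    apply intervalIntegral.integral_mono_on Real.pi_pos.le
    · apply Continuous.intervalIntegrable
      have := EE_cont a ha ha2 N i
      fun_prop
    · apply Continuous.intervalIntegrable; fun_prop
    · intro t _
      have h1 := del_le a t
      have hDp : 0 < DD a t := by linarith
      have hp : 0 ≤ Real.cos t ^ (2 * N) * Real.sin t ^ (2 * (i + 2)) := by
        rw [pow_mul, pow_mul]; positivity
      have e : Real.cos t ^ (2 * N) * Real.sin t ^ (2 * (i + 1)) / DD a t
          - 1 / (2 - a) ^ 2 * (Real.cos t ^ (2 * N) * Real.sin t ^ (2 * (i + 1)))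
          = (4 - 4 * a) / (DD a t * (2 - a) ^ 2)
            * (Real.cos t ^ (2 * N) * Real.sin t ^ (2 * (i + 2))) := by
        have e1 : (2 - a) ^ 2 - DD a t = (4 - 4 * a) * Real.sin t ^ 2 := by
          unfold DD; rw [Real.cos_sq']; ring
        have e2 : Real.sin t ^ (2 * (i + 2)) = Real.sin t ^ (2 * (i + 1)) * Real.sin t ^ 2 := by
          ring
        rw [e2]
        field_simp
        linear_combination Real.cos t ^ (2 * N) * Real.sin t ^ (2 * (i + 1)) * e1
      rw [e, abs_mul, abs_of_nonneg hp, abs_div,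
        abs_of_pos (show 0 < DD a t * (2 - a) ^ 2 by positivity)]
      gcongr
  · exact (EE_cont a ha ha2 _ _).intervalIntegrable _ _
  · apply Continuous.intervalIntegrable; fun_prop

lemma tendsto_EE (a : ℝ) (ha : 0 < a) (ha2 : a < 2) (i : ℕ) :
    Tendsto (fun N : ℕ => (N:ℝ) ^ (i+1) * EE a N i / II N 0) atTop
      (nhds (kap (i+1) / (2 - a) ^ 2)) := by
  have h1 := (tendsto_II (i+1)).div_const ((2 - a) ^ 2)
  have h2 : Tendsto (fun N : ℕ => (N:ℝ) ^ (i+1) * II N (i+2) / II N 0) atTop (nhds 0) := by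
    have := (tendsto_II (i+2)).mul (tendsto_one_div_atTop_nhds_zero_nat (𝕜 := ℝ))
    rw [mul_zero] at this
    refine this.congr' ?_
    filter_upwards [eventually_gt_atTop 0] with N hN
    have : (N:ℝ) ≠ 0 := by positivity
    field_simp
    ring
  have h3 := h2.const_mul (|4 - 4 * a| / (del a * (2 - a) ^ 2))
  rw [mul_zero] at h3
  have h4 : Tendsto (fun N : ℕ => (N:ℝ) ^ (i+1) * EE a N i / II N 0
      - (N:ℝ) ^ (i+1) * II N (i+1) / II N 0 / (2 - a) ^ 2) atTop (nhds 0) := by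
    apply squeeze_zero_norm _ h3
    intro N
    have hJ := II_zero_pos N
    have e : (N:ℝ) ^ (i+1) * EE a N i / II N 0
      - (N:ℝ) ^ (i+1) * II N (i+1) / II N 0 / (2 - a) ^ 2
      = (N:ℝ) ^ (i+1) / II N 0 * (EE a N i - 1 / (2 - a) ^ 2 * II N (i+1)) := by ring
    rw [e, Real.norm_eq_abs, abs_mul, abs_of_nonneg (by positivity)]
    calc _ ≤ (N:ℝ) ^ (i+1) / II N 0 * ((|4 - 4 * a| / (del a * (2 - a) ^ 2)) * II N (i+2)) := by
          gcongr
          exact EE_approx a ha ha2 N i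
      _ = _ := by ring
  have := h4.add h1
  rw [zero_add] at this
  refine this.congr (fun N => ?_)
  ring

/-- crude bounds for the weights of returns -/
lemma alpha_bounds (a : ℝ) (ha : 0 < a) (ha2 : a < 2) : ∃ K : ℝ, 0 ≤ K ∧ ∀ N : ℕ,
    |AA a N 0| ≤ K * 2 ^ N / (N + 1) ∧
    |AA a (N+2) 0 - 4 * AA a N 0| ≤ K * 2 ^ N / (N + 1) ^ 2 := by
  have hd := del_pos a ha ha2
  have hpi := Real.pi_pos
  refine ⟨2 * a ^ 2 / Real.pi * (12 * Real.pi / del a), by positivity, fun N => ?_⟩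
  rcases Nat.even_or_odd' N with ⟨M, rfl | rfl⟩
  · have hJ0 := II_zero_pos M
    have hJ := II_zero_le M
    have e1 := AA_EE a ha ha2 M
    have e2 : AA a (2 * M + 2) 0 - 4 * AA a (2 * M) 0
        = - (2 * a ^ 2 / Real.pi * 4 ^ M * (4 * EE a M 1)) := by
      have := AA_EE a ha ha2 (M+1)
      rw [mul_add, mul_one, EE_sub a ha ha2] at this
      rw [this, e1]; ring
    have p4 : (2:ℝ) ^ (2 * M) = 4 ^ M := by rw [pow_mul]; norm_num
    have n0 := EE_nonneg a ha ha2 M 0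
    have n1 := EE_nonneg a ha ha2 M 1
    have l0 := EE_le a ha ha2 M 0
    have l1 := EE_le a ha ha2 M 1
    rw [e2, e1, abs_neg, abs_of_nonneg (by positivity), abs_of_nonneg (by positivity), p4]
    push_cast
    rw [II_psucc] at l0 l1
    rw [II_psucc] at l1
    push_cast at l0 l1
    constructor
    · have : EE a M 0 ≤ 12 * Real.pi / del a / (2 * M + 1) := by
        refine l0.trans ?_
        calc _ ≤ 1 / del a * (Real.pi * ((2 * 0 + 1) / (2 * M + 1))) := by
              gcongr <;> linarith
          _ ≤ 12 * Real.pi / del a / (2 * M + 1) := by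
              rw [div_div, div_mul_eq_mul_div, one_mul, div_le_div_iff₀ (by positivity) (by positivity)]
              field_simp
              norm_num
      calc _ ≤ 2 * a ^ 2 / Real.pi * 4 ^ M * (12 * Real.pi / del a / (2 * M + 1)) := by gcongr
        _ = _ := by ring
    · have : 4 * EE a M 1 ≤ 12 * Real.pi / del a / (2 * M + 1) ^ 2 := by
        calc 4 * EE a M 1 ≤ 4 * (1 / del a * (Real.pi * ((2 * 0 + 1) / (2 * M + 1))
                * ((2 * 1 + 1) / (2 * M + 1)))) := by
              refine (mul_le_mul_of_nonneg_left l1 (by norm_num)).trans ?_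
              gcongr <;> linarith
          _ = 12 * Real.pi / del a / (2 * M + 1) ^ 2 := by
              field_simp
              norm_num
      calc _ ≤ 2 * a ^ 2 / Real.pi * 4 ^ M * (12 * Real.pi / del a / (2 * M + 1) ^ 2) := by gcongr
        _ = _ := by ring
  · rw [AA_par a (2*M+1) 0 (by push_cast; omega), AA_par a (2*M+1+2) 0 (by push_cast; omega)]
    simp only [mul_zero, sub_zero, abs_zero]
    constructor <;> positivity


lemma corr_lim (u : ℕ → ℝ) (K : ℝ) (i : ℕ)
    (hu : ∀ N : ℕ, |u N| ≤ K * 4 ^ N / (N + 1) ^ (i + 2)) :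
    Tendsto (fun N : ℕ => (N:ℝ) ^ (i + 1) * u N / (4 ^ N * II N 0)) atTop (nhds 0) := by
  have h := tendsto_g.const_mul K
  rw [mul_zero] at h
  apply squeeze_zero_norm _ h
  intro N
  have hJ := II_zero_pos N
  have hK : 0 ≤ K := by
    have := (abs_nonneg _).trans (hu 0)
    simpa using this
  rw [Real.norm_eq_abs, abs_div, abs_mul, abs_of_nonneg (show (0:ℝ) ≤ (N:ℝ) ^ (i+1) by positivity),
    abs_of_pos (show 0 < 4 ^ N * II N 0 by positivity)]
  calc (N:ℝ) ^ (i+1) * |u N| / (4 ^ N * II N 0)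
      ≤ ((N:ℝ) + 1) ^ (i+1) * (K * 4 ^ N / (N + 1) ^ (i + 2)) / (4 ^ N * II N 0) := by
        gcongr
        · linarith
        · exact hu N
    _ = K * (1 / (((N:ℝ) + 1) * II N 0)) := by
        field_simp
        ring

lemma main_lim (a : ℝ) (ha : 0 < a) (ha2 : a < 2) :
    Tendsto (fun N : ℕ => (N:ℝ) ^ 5 * (a ^ 2 * PG2 (2 * (N + 1)) a 1) / 16 ^ N) atTop
      (nhds (Real.pi * (6 * (2 * a ^ 2 / Real.pi / (2 - a) ^ 2) ^ 2))) := by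
  obtain ⟨K, hK, hb⟩ := alpha_bounds a ha ha2
  have hpi := Real.pi_ne_zero
  have h2a : 2 - a ≠ 0 := by linarith
  set c := 2 * a ^ 2 / Real.pi with hc
  set al : ℕ → ℝ := fun N => AA a N 0 with hal
  set ep : ℕ → ℝ := fun N => AA a (N+2) 0 - 4 * AA a N 0 with hep
  have hal' : ∀ N : ℕ, |al N| ≤ K * 2 ^ N / (N + 1) := fun N => (hb N).1
  have hep' : ∀ N : ℕ, |ep N| ≤ K * 2 ^ N / (N + 1) ^ 2 := fun N => (hb N).2
  have p4 : ∀ N : ℕ, (4:ℝ) ^ N = 2 ^ N * 2 ^ N := fun N => by rw [← mul_pow]; norm_num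
  have c0 := corr_lim (fun N => al N * al N) (K ^ 2) 0 (fun N => by
    rw [abs_mul, p4]
    calc |al N| * |al N| ≤ (K * 2 ^ N / (N + 1)) * (K * 2 ^ N / (N + 1)) := by
          gcongr <;> exact hal' N
      _ = _ := by field_simp)
  have c1 := corr_lim (fun N => al N * ep N) (K ^ 2) 1 (fun N => by
    rw [abs_mul, p4]
    calc |al N| * |ep N| ≤ (K * 2 ^ N / (N + 1)) * (K * 2 ^ N / (N + 1) ^ 2) := by
          gcongr
          · exact hal' N
          · exact hep' N
      _ = _ := by field_simp)
  have c2 := corr_lim (fun N => ep N * ep N) (K ^ 2) 2 (fun N => by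
    rw [abs_mul, p4]
    calc |ep N| * |ep N| ≤ (K * 2 ^ N / (N + 1) ^ 2) * (K * 2 ^ N / (N + 1) ^ 2) := by
          gcongr <;> exact hep' N
      _ = _ := by field_simp)
  have X := ((tendsto_EE a ha ha2 0).const_mul c).sub (c0.div_const a)
  have Y := ((tendsto_EE a ha ha2 1).const_mul (4 * c)).add (c1.div_const a)
  have Z := ((tendsto_EE a ha ha2 2).const_mul (16 * c)).sub (c2.div_const a)
  have T := tendsto_NJ.mul ((X.mul Z).sub (Y.pow 2))
  have e : Real.pi * ((c * (kap (0 + 1) / (2 - a) ^ 2) - 0 / a) *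
      (16 * c * (kap (2 + 1) / (2 - a) ^ 2) - 0 / a)
      - (4 * c * (kap (1 + 1) / (2 - a) ^ 2) + 0 / a) ^ 2)
      = Real.pi * (6 * (c / (2 - a) ^ 2) ^ 2) := by
    simp only [kap]
    push_cast
    ring
  rw [e] at T
  refine T.congr (fun N => ?_)
  have hJ := (II_zero_pos N).ne'
  rw [PG2_formula a ha.ne' N]
  have q0 : AA a (2 * N) 0 = c * 4 ^ N * EE a N 0 := AA_EE a ha ha2 N
  have q1 : AA a (2 * N + 2) 0 = c * 4 ^ N * (4 * EE a N 0 - 4 * EE a N 1) := by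
    have := AA_EE a ha ha2 (N+1)
    rw [mul_add, mul_one, EE_sub a ha ha2] at this
    rw [this, pow_succ]; ring
  have q2 : AA a (2 * N + 4) 0 = c * 4 ^ N * (16 * EE a N 0 - 32 * EE a N 1 + 16 * EE a N 2) := by
    have := AA_EE a ha ha2 (N+2)
    rw [show 2 * (N + 2) = 2 * N + 4 by ring, show N + 2 = N + 1 + 1 by ring,
      EE_sub a ha ha2, EE_sub a ha ha2, EE_sub a ha ha2] at this
    rw [this, pow_succ, pow_succ]; ring
  have q3 : AA a N 0 = al N := rfl
  have q4 : AA a (N+2) 0 = ep N + 4 * al N := by simp only [hal, hep]; ring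
  have p16 : (16:ℝ) ^ N = 4 ^ N * 4 ^ N := by rw [← mul_pow]; norm_num
  rw [q0, q1, q2, q3, q4, p16]
  have ha' := ha.ne'
  have h4 : (4:ℝ) ^ N ≠ 0 := by positivity
  clear_value al ep c
  generalize (4:ℝ) ^ N = F at *
  generalize EE a N 0 = x0
  generalize EE a N 1 = x1
  generalize EE a N 2 = x2
  generalize II N 0 = J at *
  generalize al N = u
  generalize ep N = v
  field_simp
  ring


/-- Asymptotics of `P^{G2}_{2n}(a,1)` for `0 < a < 2`, along even `n`. -/
theorem PG2_asymp_asmall_y1 (a : ℝ) (ha : 0 < a) (ha2 : a < 2) :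
    Tendsto (fun j : ℕ =>
        PG2 (2 * j) a 1 * ((2 * j : ℕ) : ℝ) ^ 5 / (4 : ℝ) ^ (2 * j))
      atTop (nhds (48 * a ^ 2 / (Real.pi * (a - 2) ^ 4))) := by
  have h := main_lim a ha ha2
  rw [← tendsto_add_atTop_iff_nat 1]
  have hq : Tendsto (fun N : ℕ => 2 / a ^ 2 * (((N:ℝ) + 1) / N) ^ 5) atTop (nhds (2 / a ^ 2)) := by
    have h1 : Tendsto (fun N : ℕ => ((N:ℝ) + 1) / N) atTop (nhds 1) := by
      have := (tendsto_const_nhds (x := (1:ℝ))).add (tendsto_one_div_atTop_nhds_zero_nat (𝕜 := ℝ))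
      rw [add_zero] at this
      refine this.congr' ?_
      filter_upwards [eventually_gt_atTop 0] with N hN
      have : (N:ℝ) ≠ 0 := by positivity
      field_simp
    have := (h1.pow 5).const_mul (2 / a ^ 2)
    rw [one_pow, mul_one] at this
    exact this
  have T := hq.mul h
  have hpi := Real.pi_ne_zero
  have h2a : 2 - a ≠ 0 := by linarith
  have h2b : a - 2 ≠ 0 := by linarith
  have e : 2 / a ^ 2 * (Real.pi * (6 * (2 * a ^ 2 / Real.pi / (2 - a) ^ 2) ^ 2))
      = 48 * a ^ 2 / (Real.pi * (a - 2) ^ 4) := by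
    have : (a - 2) ^ 4 = (2 - a) ^ 4 := by ring
    rw [this]
    field_simp
    norm_num
  rw [e] at T
  refine T.congr' ?_
  filter_upwards [eventually_gt_atTop 0] with N hN
  have hN' : (N:ℝ) ≠ 0 := by positivity
  have ha' := ha.ne'
  have p16 : (4:ℝ) ^ (2 * (N+1)) = 16 * 16 ^ N := by
    rw [pow_mul, pow_succ]; norm_num; ring
  rw [p16]
  push_cast
  field_simp
  ring
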